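/- Let R be a finite local ring with identity, with |R| = q^n, whose residue field R/J has q elements, where J = J(R) is the Jacobson radical, and suppose J² = 0. Then P_x(R) = 2(q−1)/q^{n+1} if x ∈ J is nonzero, P_x(R) = (q−1)/q^{n+1} if x ∉ J, and P_0(R) = (q^{n−1} + 2q − 2)/q^{n+1}. -/

import Mathlib

/-- The multiplication probability of a finite ring `R` at `x`:
`P_x(R) = |{(a,b) ∈ R × R : a*b = x}| / |R|²`. -/
noncomputable def mulProb (R : Type*) [Ring R] (x : R) : ℚ :=
  (Nat.card {p : R × R // p.1 * p.2 = x} : ℚ) / (Nat.card R : ℚ) ^ 2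

/-- The Jacobson radical of a ring, as a two-sided ideal. -/
abbrev jacobsonRadical (R : Type*) [Ring R] : TwoSidedIdeal R :=
  (⊥ : TwoSidedIdeal R).jacobson

/-- The residue ring `R/J(R)` of a ring modulo its Jacobson radical. -/
abbrev residueRing (R : Type*) [Ring R] : Type _ :=
  (jacobsonRadical R).ringCon.Quotient

open Pointwise in
/-- Powers of a two-sided ideal, as additive submonoids of `R`: `J⁰ = R`, `J¹ = J`, and
`J^(k+1) = J · J^k` (the product ideal). -/
def idealPow {R : Type*} [Ring R] (J : TwoSidedIdeal R) : ℕ → AddSubmonoid R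
  | 0 => ⊤
  | 1 => J.asIdeal.toAddSubmonoid
  | (k + 2) => J.asIdeal.toAddSubmonoid * idealPow J (k + 1)

lemma mem_jac_iff' {R : Type*} [Ring R] [Finite R] [IsLocalRing R] (x : R) :
    x ∈ jacobsonRadical R ↔ ¬ IsUnit x := by
  rw [TwoSidedIdeal.mem_jacobson_iff]
  constructor
  · rintro h ⟨u, rfl⟩
    obtain ⟨z, hz⟩ := h (-(↑u⁻¹ : R))
    rw [TwoSidedIdeal.mem_bot] at hz
    simp [mul_assoc] at hz
  · intro h y
    have h1 : ¬ IsUnit (-(y * x)) := by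
      intro hu
      apply h
      rw [IsUnit.neg_iff] at hu
      obtain ⟨u, hu⟩ := hu
      have : (↑u⁻¹ * y) * x = 1 := by rw [mul_assoc, ← hu]; simp
      exact IsUnit.of_mul_eq_one_right _ this
    have h2 : IsUnit (1 + y * x) :=
      (IsLocalRing.isUnit_or_isUnit_of_add_one
        (show -(y * x) + (1 + y * x) = 1 by abel)).resolve_left h1
    obtain ⟨u, hu⟩ := h2
    refine ⟨↑u⁻¹, ?_⟩
    rw [TwoSidedIdeal.mem_bot, sub_eq_zero]
    have : (↑u⁻¹ : R) * (1 + y * x) = 1 := by rw [← hu]; simp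
    rw [← this]; noncomm_ring

lemma mul_zero_of_sq {R : Type*} [Ring R]
    (hJ2 : idealPow (jacobsonRadical R) 2 = ⊥) {a b : R}
    (ha : a ∈ jacobsonRadical R) (hb : b ∈ jacobsonRadical R) : a * b = 0 := by
  have : a * b ∈ idealPow (jacobsonRadical R) 2 := by
    simp only [idealPow]
    exact AddSubmonoid.mul_mem_mul (by simpa using ha) (by simpa using hb)
  rw [hJ2] at this
  simpa using this

lemma card_units_add {R : Type*} [Ring R] [Finite R] [IsLocalRing R] :
    Nat.card Rˣ + (jacobsonRadical R : Set R).ncard = Nat.card R := by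
  have h : (jacobsonRadical R : Set R) = (Set.range (Units.val : Rˣ → R))ᶜ := by
    ext x
    rw [SetLike.mem_coe, mem_jac_iff']
    rfl
  rw [h, ← Set.ncard_add_ncard_compl (Set.range (Units.val : Rˣ → R)),
    ← Set.image_univ, Set.ncard_image_of_injective _ Units.val_injective, Set.ncard_univ]

lemma card_mul_jac {R : Type*} [Ring R] :
    Nat.card R = Nat.card (residueRing R) * (jacobsonRadical R : Set R).ncard := by
  let s : AddSubgroup R := (jacobsonRadical R).asIdeal.toAddSubgroup
  have h := AddSubgroup.card_eq_card_quotient_mul_card_addSubgroup s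
  have e : residueRing R ≃ R ⧸ s := by
    refine Quotient.congr (Equiv.refl R) ?_
    intro a b
    change (jacobsonRadical R).ringCon a b ↔ QuotientAddGroup.leftRel s a b
    rw [QuotientAddGroup.leftRel_apply, TwoSidedIdeal.rel_iff, ← neg_mem_iff]
    change _ ↔ -a + b ∈ jacobsonRadical R
    rw [neg_sub, neg_add_eq_sub]
  rw [h, Nat.card_congr e]
  rfl

section
variable {R : Type*} [Ring R]

lemma ncard_A (x : R) :
    (Set.range (fun u : Rˣ => ((u : R), (↑u⁻¹ : R) * x))).ncard = Nat.card Rˣ := by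
  rw [← Set.image_univ, Set.ncard_image_of_injective, Set.ncard_univ]
  intro u v h
  exact Units.ext (Prod.ext_iff.1 h).1

lemma ncard_B (x : R) :
    (Set.range (fun u : Rˣ => (x * (↑u⁻¹ : R), (u : R)))).ncard = Nat.card Rˣ := by
  rw [← Set.image_univ, Set.ncard_image_of_injective, Set.ncard_univ]
  intro u v h
  exact Units.ext (Prod.ext_iff.1 h).2

lemma mem_A (x : R) (p : R × R) :
    p ∈ Set.range (fun u : Rˣ => ((u : R), (↑u⁻¹ : R) * x)) ↔ IsUnit p.1 ∧ p.1 * p.2 = x := by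
  constructor
  · rintro ⟨u, rfl⟩; simp
  · rintro ⟨⟨u, hu⟩, h⟩
    refine ⟨u, Prod.ext hu ?_⟩
    simp [← h, ← hu]

lemma mem_B (x : R) (p : R × R) :
    p ∈ Set.range (fun u : Rˣ => (x * (↑u⁻¹ : R), (u : R))) ↔ IsUnit p.2 ∧ p.1 * p.2 = x := by
  constructor
  · rintro ⟨u, rfl⟩; simp
  · rintro ⟨⟨u, hu⟩, h⟩
    refine ⟨u, Prod.ext ?_ hu⟩
    simp [← h, ← hu]

variable [Finite R] [IsLocalRing R]

lemma count_unit (x : R) (hx : x ∉ jacobsonRadical R) :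
    Nat.card {p : R × R // p.1 * p.2 = x} = Nat.card Rˣ := by
  rw [mem_jac_iff', not_not] at hx
  rw [← ncard_A x]
  change Set.ncard {p : R × R | p.1 * p.2 = x} = _
  congr 1
  ext p
  rw [mem_A]
  refine ⟨fun h => ⟨?_, h⟩, fun h => h.2⟩
  obtain ⟨u, hu⟩ := hx
  have h' : p.1 * p.2 = x := h
  refine IsUnit.of_mul_eq_one (p.2 * ↑u⁻¹) ?_
  rw [← mul_assoc, h', ← hu]; simp

lemma disj_AB (x : R) (hx : x ∈ jacobsonRadical R) :
    Disjoint (Set.range (fun u : Rˣ => ((u : R), (↑u⁻¹ : R) * x)))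
      (Set.range (fun u : Rˣ => (x * (↑u⁻¹ : R), (u : R)))) := by
  rw [Set.disjoint_left]
  intro p ha hb
  rw [mem_A] at ha
  rw [mem_B] at hb
  rw [mem_jac_iff'] at hx
  exact hx (ha.2 ▸ ha.1.mul hb.1)

lemma count_nonzero (hJ2 : idealPow (jacobsonRadical R) 2 = ⊥)
    (x : R) (hx : x ∈ jacobsonRadical R) (h0 : x ≠ 0) :
    Nat.card {p : R × R // p.1 * p.2 = x} = Nat.card Rˣ + Nat.card Rˣ := by
  nth_rw 1 [← ncard_A x]
  rw [← ncard_B x, ← Set.ncard_union_eq (disj_AB x hx)]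
  change Set.ncard {p : R × R | p.1 * p.2 = x} = _
  congr 1
  ext p
  rw [Set.mem_union, mem_A, mem_B, Set.mem_ofPred_eq]
  have := @mul_zero_of_sq R _ hJ2 p.1 p.2
  rw [mem_jac_iff', mem_jac_iff'] at this
  grind

lemma count_zero (hJ2 : idealPow (jacobsonRadical R) 2 = ⊥) :
    Nat.card {p : R × R // p.1 * p.2 = 0} = Nat.card Rˣ + Nat.card Rˣ +
      (jacobsonRadical R : Set R).ncard * (jacobsonRadical R : Set R).ncard := by
  nth_rw 1 [← ncard_A (0 : R)]
  rw [← ncard_B (0 : R), ← Set.ncard_union_eq (disj_AB (0 : R) (zero_mem _)), ← Set.ncard_prod,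
    ← Set.ncard_union_eq]
  · change Set.ncard {p : R × R | p.1 * p.2 = 0} = _
    congr 1
    ext p
    rw [Set.mem_union, Set.mem_union, mem_A, mem_B, Set.mem_ofPred_eq, Set.mem_prod,
      SetLike.mem_coe, SetLike.mem_coe]
    have := @mul_zero_of_sq R _ hJ2 p.1 p.2
    rw [mem_jac_iff', mem_jac_iff'] at *
    grind
  · rw [Set.disjoint_left]
    intro p
    rw [Set.mem_union, mem_A, mem_B, Set.mem_prod,
      SetLike.mem_coe, SetLike.mem_coe, mem_jac_iff', mem_jac_iff']
    grind

end

/-- Let `R` be a finite local ring with `|R| = qⁿ`, whose residue field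
`R/J` has `q` elements, and suppose `J² = 0`. Then `P_x(R) = 2(q−1)/q^{n+1}` for nonzero
`x ∈ J`, `P_x(R) = (q−1)/q^{n+1}` for `x ∉ J`, and `P_0(R) = (q^{n−1} + 2q − 2)/q^{n+1}`. -/
theorem mulProb_of_radical_sq_eq_zero
    {R : Type*} [Ring R] [Finite R] [IsLocalRing R] {q n : ℕ}
    (hcard : Nat.card R = q ^ n) (hres : Nat.card (residueRing R) = q)
    (hJ2 : idealPow (jacobsonRadical R) 2 = ⊥) :
    (∀ x ∈ jacobsonRadical R, x ≠ 0 →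
        mulProb R x = 2 * ((q : ℚ) - 1) / (q : ℚ) ^ (n + 1)) ∧
    (∀ x : R, x ∉ jacobsonRadical R → mulProb R x = ((q : ℚ) - 1) / (q : ℚ) ^ (n + 1)) ∧
    mulProb R 0 = ((q : ℚ) ^ (n - 1) + 2 * (q : ℚ) - 2) / (q : ℚ) ^ (n + 1) := by
  have hU := card_units_add (R := R)
  have hM := card_mul_jac (R := R)
  rw [hres] at hM
  rw [hcard] at hU hM
  have h2 : 1 < Nat.card R := Finite.one_lt_card
  rw [hcard] at h2
  obtain ⟨m, rfl⟩ : ∃ m, n = m + 1 := by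
    cases n with
    | zero => simp at h2
    | succ m => exact ⟨m, rfl⟩
  have hq : 0 < q := by
    rcases Nat.eq_zero_or_pos q with h | h
    · simp [h] at h2
    · exact h
  have hj : (jacobsonRadical R : Set R).ncard = q ^ m := by
    apply Nat.eq_of_mul_eq_mul_left hq
    rw [← hM, pow_succ']
  rw [hj] at hU
  have hq' : (q : ℚ) ≠ 0 := by exact_mod_cast hq.ne'
  have hUq : (Nat.card Rˣ : ℚ) = (q : ℚ) ^ m * (q - 1) := by
    have : (Nat.card Rˣ : ℚ) + (q : ℚ) ^ m = (q : ℚ) ^ (m + 1) := by exact_mod_cast hU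
    rw [pow_succ] at this
    linarith
  refine ⟨fun x hx h0 => ?_, fun x hx => ?_, ?_⟩
  · rw [mulProb, count_nonzero hJ2 x hx h0, hcard]
    push_cast
    rw [hUq]
    field_simp
    ring
  · rw [mulProb, count_unit x hx, hcard]
    push_cast
    rw [hUq]
    field_simp
    try ring
  · rw [mulProb, count_zero hJ2, hcard, hj]
    push_cast
    rw [hUq]
    field_simp
    ring
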